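/- Let (g,[·,·],α) be a multiplicative Hom-Lie superalgebra over a field K of characteristic zero, n ≥ 3, let φ be an even super-skew-symmetric (n−2)-linear form on g satisfying the two conditions making (g,[·,…,·]_φ,α) a multiplicative n-Hom-Lie superalgebra, and let D be a homogeneous α^k-quasiderivation of g with associated endomorphism D′ (so [D(x),α^k(y)] + (−1)^{|D||x|}[α^k(x),D(y)] = D′([x,y]) for all homogeneous x,y) such that Σ_{i=1}^{n−2} (−1)^{|D||X|^{i−1}} φ(x₁,…,D(xᵢ),…,x_{n−2}) = 0 for all homogeneous x₁,…,x_{n−2}. Then D is an α^k-quasiderivation of the n-Hom-Lie superalgebra (g,[·,…,·]_φ,α) with the same associated endomorphism D′: Σ_{i=1}^{n} (−1)^{|D||X|^{i−1}} [α^k(x₁),…,D(xᵢ),…,α^k(xₙ)]_φ = D′([x₁,…,xₙ]_φ). -/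

import Mathlib

namespace NHomSuper

/-- The sign `(-1)^d` associated to a degree `d : ℤ₂`. -/
def sgn (K : Type*) [Field K] (d : ZMod 2) : K := (-1 : K) ^ d.val

variable {K : Type*} [Field K] [CharZero K]
variable {V : Type*} [AddCommGroup V] [Module K V]

/-- Sum of the degrees of the entries strictly before position `i`:  `|X|^{i-1}`. -/
def partSum {n : ℕ} (d : Fin n → ZMod 2) (i : Fin n) : ZMod 2 :=
  ∑ j ∈ Finset.univ.filter (fun j => j < i), d j

/-- Sum of the degrees of the entries strictly after position `j`. -/
def sumAfter {n : ℕ} (d : Fin n → ZMod 2) (j : Fin n) : ZMod 2 :=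
  ∑ k ∈ Finset.univ.filter (fun k => j < k), d k

/-- Sum of the degrees of the entries strictly between positions `i` and `j`. -/
def sumBetween {n : ℕ} (d : Fin n → ZMod 2) (i j : Fin n) : ZMod 2 :=
  ∑ k ∈ Finset.univ.filter (fun k => i < k ∧ k < j), d k

/-- The exponent `γ^X_{ij} = (|x_i|+|x_j|)(|x_{j+1}|+⋯+|x_n|) + |x_i|(|x_{i+1}|+⋯+|x_{j-1}|)`. -/
def gamma {n : ℕ} (d : Fin n → ZMod 2) (i j : Fin n) : ZMod 2 :=
  (d i + d j) * sumAfter d j + d i * sumBetween d i j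

/-- The increasing embedding `Fin (m+1) → Fin (m+3)` omitting the two positions `i < j`. -/
def skip2 {m : ℕ} (i j : Fin (m + 3)) (k : Fin (m + 1)) : Fin (m + 3) :=
  if h1 : (k : ℕ) < (i : ℕ) then ⟨(k : ℕ), lt_trans h1 i.isLt⟩
  else if h2 : (k : ℕ) + 1 < (j : ℕ) then ⟨(k : ℕ) + 1, lt_trans h2 j.isLt⟩
  else ⟨(k : ℕ) + 2, by have hk := k.isLt; omega⟩

/-- A Hom-Lie superalgebra structure on the ℤ₂-graded vector space `V` with grading `gr`. -/
structure IsHomLieSuper (gr : ZMod 2 → Submodule K V)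
    (br : V →ₗ[K] V →ₗ[K] V) (α : Module.End K V) : Prop where
  internal : DirectSum.IsInternal gr
  alpha_even : ∀ (a : ZMod 2) (x : V), x ∈ gr a → α x ∈ gr a
  br_even : ∀ (a b : ZMod 2) (x y : V), x ∈ gr a → y ∈ gr b → br x y ∈ gr (a + b)
  skew : ∀ (a b : ZMod 2) (x y : V), x ∈ gr a → y ∈ gr b →
    br x y = - sgn K (a * b) • br y x
  jacobi : ∀ (a b c : ZMod 2) (x y z : V), x ∈ gr a → y ∈ gr b → z ∈ gr c →
    sgn K (a * c) • br (α x) (br y z) + sgn K (b * a) • br (α y) (br z x)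
      + sgn K (c * b) • br (α z) (br x y) = 0

/-- An even multilinear form: it vanishes on homogeneous tuples of nonzero total degree. -/
def FormEven (gr : ZMod 2 → Submodule K V) {p : ℕ}
    (φ : MultilinearMap K (fun _ : Fin p => V) K) : Prop :=
  ∀ (d : Fin p → ZMod 2) (x : Fin p → V), (∀ i, x i ∈ gr (d i)) →
    (∑ i, d i) ≠ 0 → φ x = 0

/-- A super-skew-symmetric multilinear form (adjacent transpositions). -/
def FormSuperSkew (gr : ZMod 2 → Submodule K V) {p : ℕ}
    (φ : MultilinearMap K (fun _ : Fin p => V) K) : Prop :=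
  ∀ (d : Fin p → ZMod 2) (x : Fin p → V), (∀ i, x i ∈ gr (d i)) →
    ∀ i j : Fin p, (j : ℕ) = (i : ℕ) + 1 →
      φ x = - sgn K (d i * d j) * φ (x ∘ Equiv.swap i j)

/-- The `n`-ary product `[x₁,…,xₙ]_φ` (here `n = m+3`) induced by a binary bracket `br`
and an `(n-2)`-cochain `φ`, for a homogeneous tuple `x` with degrees `d`. -/
def phiBr {m : ℕ} (br : V →ₗ[K] V →ₗ[K] V)
    (φ : MultilinearMap K (fun _ : Fin (m + 1) => V) K)
    (d : Fin (m + 3) → ZMod 2) (x : Fin (m + 3) → V) : V :=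
  ∑ p ∈ Finset.univ.filter (fun p : Fin (m + 3) × Fin (m + 3) => p.1 < p.2),
    ((-1 : K) ^ ((p.1 : ℕ) + (p.2 : ℕ) + 1) * sgn K (gamma d p.1 p.2)
      * φ (x ∘ skip2 p.1 p.2)) • br (x p.1) (x p.2)

/-- Condition `φ ∧ δφ_X = 0` of Theorem 2.9. -/
def PhiCond1 {m : ℕ} (gr : ZMod 2 → Submodule K V) (br : V →ₗ[K] V →ₗ[K] V)
    (φ : MultilinearMap K (fun _ : Fin (m + 1) => V) K) : Prop :=
  ∀ (dx : Fin m → ZMod 2) (x : Fin m → V) (dy : Fin (m + 3) → ZMod 2)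
      (y : Fin (m + 3) → V),
    (∀ i, x i ∈ gr (dx i)) → (∀ i, y i ∈ gr (dy i)) →
    ∑ p ∈ Finset.univ.filter (fun p : Fin (m + 3) × Fin (m + 3) => p.1 < p.2),
      (-1 : K) ^ ((p.1 : ℕ) + (p.2 : ℕ)) * sgn K (gamma dy p.1 p.2)
        * φ (y ∘ skip2 p.1 p.2) * φ (Fin.snoc x (br (y p.1) (y p.2))) = 0

/-- Condition `φ ∘ (α ⊗ Id ⊗ ⋯ ⊗ Id) = φ`. -/
def PhiCond2 {m : ℕ} (φ : MultilinearMap K (fun _ : Fin (m + 1) => V) K)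
    (α : Module.End K V) : Prop :=
  ∀ x : Fin (m + 1) → V, φ (Function.update x 0 (α (x 0))) = φ x

/-- A multiplicative `n`-Hom-Lie superalgebra structure (`n = m+3`) given by a
degree-parametrized `n`-linear bracket `B` on homogeneous tuples. -/
structure IsMultNHomLieSuperGr {m : ℕ} (gr : ZMod 2 → Submodule K V)
    (B : (Fin (m + 3) → ZMod 2) → (Fin (m + 3) → V) → V) (α : Module.End K V) : Prop where
  internal : DirectSum.IsInternal gr
  alpha_even : ∀ (a : ZMod 2) (x : V), x ∈ gr a → α x ∈ gr a
  map_add : ∀ (d : Fin (m + 3) → ZMod 2) (x : Fin (m + 3) → V) (i : Fin (m + 3)) (u v : V),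
    B d (Function.update x i (u + v)) = B d (Function.update x i u) + B d (Function.update x i v)
  map_smul : ∀ (d : Fin (m + 3) → ZMod 2) (x : Fin (m + 3) → V) (i : Fin (m + 3)) (c : K) (u : V),
    B d (Function.update x i (c • u)) = c • B d (Function.update x i u)
  even : ∀ (d : Fin (m + 3) → ZMod 2) (x : Fin (m + 3) → V), (∀ i, x i ∈ gr (d i)) →
    B d x ∈ gr (∑ i, d i)
  skew : ∀ (d : Fin (m + 3) → ZMod 2) (x : Fin (m + 3) → V), (∀ i, x i ∈ gr (d i)) →
    ∀ i j : Fin (m + 3), (j : ℕ) = (i : ℕ) + 1 →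
      B d x = - sgn K (d i * d j) • B (d ∘ Equiv.swap i j) (x ∘ Equiv.swap i j)
  mult : ∀ (d : Fin (m + 3) → ZMod 2) (x : Fin (m + 3) → V), (∀ i, x i ∈ gr (d i)) →
    α (B d x) = B d (fun i => α (x i))
  nambu : ∀ (dx : Fin (m + 2) → ZMod 2) (x : Fin (m + 2) → V)
      (dy : Fin (m + 3) → ZMod 2) (y : Fin (m + 3) → V),
      (∀ i, x i ∈ gr (dx i)) → (∀ i, y i ∈ gr (dy i)) →
    B (Fin.snoc dx (∑ i, dy i)) (Fin.snoc (fun i => α (x i)) (B dy y)) =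
      ∑ i : Fin (m + 3), sgn K ((∑ k, dx k) * partSum dy i) •
        B (Function.update dy i ((∑ k, dx k) + dy i))
          (Function.update (fun j => α (y j)) i (B (Fin.snoc dx (dy i)) (Fin.snoc x (y i))))

/-- An `n`-ary Hom-Nambu superalgebra structure (`n = p+2`) with (degree-free) bracket `nbr`. -/
structure IsNaryHomNambuSuper {p : ℕ} (gr : ZMod 2 → Submodule K V)
    (nbr : (Fin (p + 2) → V) → V) (β : Module.End K V) : Prop where
  internal : DirectSum.IsInternal gr
  alpha_even : ∀ (a : ZMod 2) (x : V), x ∈ gr a → β x ∈ gr a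
  map_add : ∀ (x : Fin (p + 2) → V) (i : Fin (p + 2)) (u v : V),
    nbr (Function.update x i (u + v)) = nbr (Function.update x i u) + nbr (Function.update x i v)
  map_smul : ∀ (x : Fin (p + 2) → V) (i : Fin (p + 2)) (c : K) (u : V),
    nbr (Function.update x i (c • u)) = c • nbr (Function.update x i u)
  even : ∀ (d : Fin (p + 2) → ZMod 2) (x : Fin (p + 2) → V), (∀ i, x i ∈ gr (d i)) →
    nbr x ∈ gr (∑ i, d i)
  nambu : ∀ (dx : Fin (p + 1) → ZMod 2) (x : Fin (p + 1) → V)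
      (dy : Fin (p + 2) → ZMod 2) (y : Fin (p + 2) → V),
      (∀ i, x i ∈ gr (dx i)) → (∀ i, y i ∈ gr (dy i)) →
    nbr (Fin.snoc (fun i => β (x i)) (nbr y)) =
      ∑ i : Fin (p + 2), sgn K ((∑ k, dx k) * partSum dy i) •
        nbr (Function.update (fun j => β (y j)) i (nbr (Fin.snoc x (y i))))

/-- A multiplicative `n`-ary Hom-Nambu superalgebra (`n = p+2`). -/
structure IsMultNaryHomNambuSuper {p : ℕ} (gr : ZMod 2 → Submodule K V)
    (nbr : (Fin (p + 2) → V) → V) (β : Module.End K V)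
    extends IsNaryHomNambuSuper gr nbr β : Prop where
  mult : ∀ x : Fin (p + 2) → V, β (nbr x) = nbr fun i => β (x i)

/-- The `n`-ary bracket (`n = p+2`) induced by a binary Hom-Lie superalgebra bracket:
`[x₁,…,xₙ]ₙ = [[…[[x₁,x₂],α(x₃)],…],α^{n-2}(xₙ)]`. -/
def nBr (br : V →ₗ[K] V →ₗ[K] V) (α : Module.End K V) : (p : ℕ) → (Fin (p + 2) → V) → V
  | 0, x => br (x 0) (x 1)
  | p + 1, x => br (nBr br α p (Fin.init x)) ((α ^ (p + 1)) (x (Fin.last (p + 2))))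

/-- A homogeneous `α^k`-derivation of degree `dD` of a binary Hom-superalgebra. -/
def IsAlphaKDeriv2 (gr : ZMod 2 → Submodule K V) (br : V →ₗ[K] V →ₗ[K] V)
    (α : Module.End K V) (k : ℕ) (dD : ZMod 2) (D : Module.End K V) : Prop :=
  D * α = α * D ∧ (∀ (a : ZMod 2) (x : V), x ∈ gr a → D x ∈ gr (a + dD)) ∧
  ∀ (a b : ZMod 2) (x y : V), x ∈ gr a → y ∈ gr b →
    D (br x y) = br (D x) ((α ^ k) y) + sgn K (dD * a) • br ((α ^ k) x) (D y)

/-- A homogeneous `α^k`-derivation of degree `dD` of an `n`-ary Hom-superalgebra (`n = p+2`). -/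
def IsNaryAlphaKDeriv {p : ℕ} (gr : ZMod 2 → Submodule K V)
    (nbr : (Fin (p + 2) → V) → V) (α : Module.End K V) (k : ℕ) (dD : ZMod 2)
    (D : Module.End K V) : Prop :=
  D * α = α * D ∧ (∀ (a : ZMod 2) (x : V), x ∈ gr a → D x ∈ gr (a + dD)) ∧
  ∀ (dy : Fin (p + 2) → ZMod 2) (y : Fin (p + 2) → V), (∀ i, y i ∈ gr (dy i)) →
    D (nbr y) = ∑ i : Fin (p + 2), sgn K (dD * partSum dy i) •
      nbr (Function.update (fun j => (α ^ k) (y j)) i (D (y i)))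

/-- Rota-Baxter operator of weight `0` on a binary Hom-superalgebra. -/
def IsRotaBaxter2 (gr : ZMod 2 → Submodule K V) (br : V →ₗ[K] V →ₗ[K] V)
    (α : Module.End K V) (R : Module.End K V) : Prop :=
  (∀ (a : ZMod 2) (x : V), x ∈ gr a → R x ∈ gr a) ∧ R * α = α * R ∧
  ∀ x y : V, br (R x) (R y) = R (br (R x) y + br x (R y))

/-- The `3`-supercommutator of a ternary product, on homogeneous elements of degrees `a,b,c`. -/
def cbr (T : V → V → V → V) (a b c : ZMod 2) (x y z : V) : V :=
  T x y z + sgn K (a * (b + c)) • T y z x + sgn K (c * (a + b)) • T z x y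

/-- A `3`-Hom-Lie superalgebra structure. -/
structure Is3HomLieSuper (gr : ZMod 2 → Submodule K V)
    (br : V →ₗ[K] V →ₗ[K] V →ₗ[K] V) (α : Module.End K V) : Prop where
  internal : DirectSum.IsInternal gr
  alpha_even : ∀ (a : ZMod 2) (x : V), x ∈ gr a → α x ∈ gr a
  even : ∀ (a b c : ZMod 2) (x y z : V), x ∈ gr a → y ∈ gr b → z ∈ gr c →
    br x y z ∈ gr (a + b + c)
  skew12 : ∀ (a b c : ZMod 2) (x y z : V), x ∈ gr a → y ∈ gr b → z ∈ gr c →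
    br x y z = - sgn K (a * b) • br y x z
  skew23 : ∀ (a b c : ZMod 2) (x y z : V), x ∈ gr a → y ∈ gr b → z ∈ gr c →
    br x y z = - sgn K (b * c) • br x z y
  nambu : ∀ (a₁ a₂ b₁ b₂ b₃ : ZMod 2) (x₁ x₂ y₁ y₂ y₃ : V),
    x₁ ∈ gr a₁ → x₂ ∈ gr a₂ → y₁ ∈ gr b₁ → y₂ ∈ gr b₂ → y₃ ∈ gr b₃ →
    br (α x₁) (α x₂) (br y₁ y₂ y₃) =
      br (br x₁ x₂ y₁) (α y₂) (α y₃)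
      + sgn K ((a₁ + a₂) * b₁) • br (α y₁) (br x₁ x₂ y₂) (α y₃)
      + sgn K ((a₁ + a₂) * (b₁ + b₂)) • br (α y₁) (α y₂) (br x₁ x₂ y₃)

/-- A `3`-Hom-pre-Lie superalgebra structure. -/
structure Is3HomPreLieSuper (gr : ZMod 2 → Submodule K V)
    (T : V →ₗ[K] V →ₗ[K] V →ₗ[K] V) (α : Module.End K V) : Prop where
  internal : DirectSum.IsInternal gr
  alpha_even : ∀ (a : ZMod 2) (x : V), x ∈ gr a → α x ∈ gr a
  even : ∀ (a b c : ZMod 2) (x y z : V), x ∈ gr a → y ∈ gr b → z ∈ gr c →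
    T x y z ∈ gr (a + b + c)
  skew12 : ∀ (a b c : ZMod 2) (x y z : V), x ∈ gr a → y ∈ gr b → z ∈ gr c →
    T x y z = - sgn K (a * b) • T y x z
  ax2 : ∀ (a₁ a₂ a₃ a₄ a₅ : ZMod 2) (x₁ x₂ x₃ x₄ x₅ : V),
    x₁ ∈ gr a₁ → x₂ ∈ gr a₂ → x₃ ∈ gr a₃ → x₄ ∈ gr a₄ → x₅ ∈ gr a₅ →
    T (α x₁) (α x₂) (T x₃ x₄ x₅) =
      T (cbr (K := K) (fun u v w => T u v w) a₁ a₂ a₃ x₁ x₂ x₃) (α x₄) (α x₅)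
      + sgn K (a₃ * (a₁ + a₂)) •
          T (α x₃) (cbr (K := K) (fun u v w => T u v w) a₁ a₂ a₄ x₁ x₂ x₄) (α x₅)
      + sgn K ((a₁ + a₂) * (a₃ + a₄)) • T (α x₃) (α x₄) (T x₁ x₂ x₅)
  ax3 : ∀ (a₁ a₂ a₃ a₄ a₅ : ZMod 2) (x₁ x₂ x₃ x₄ x₅ : V),
    x₁ ∈ gr a₁ → x₂ ∈ gr a₂ → x₃ ∈ gr a₃ → x₄ ∈ gr a₄ → x₅ ∈ gr a₅ →
    T (cbr (K := K) (fun u v w => T u v w) a₁ a₂ a₃ x₁ x₂ x₃) (α x₄) (α x₅) =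
      T (α x₁) (α x₂) (T x₃ x₄ x₅)
      + sgn K (a₁ * (a₂ + a₃)) • T (α x₂) (α x₃) (T x₁ x₄ x₅)
      + sgn K (a₃ * (a₁ + a₂)) • T (α x₃) (α x₁) (T x₂ x₄ x₅)

/-- Rota-Baxter operator of weight `0` on a `3`-Hom-Lie superalgebra. -/
def IsRotaBaxter3 (gr : ZMod 2 → Submodule K V)
    (br : V →ₗ[K] V →ₗ[K] V →ₗ[K] V) (α : Module.End K V) (R : Module.End K V) : Prop :=
  (∀ (a : ZMod 2) (x : V), x ∈ gr a → R x ∈ gr a) ∧ R * α = α * R ∧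
  ∀ x y z : V, br (R x) (R y) (R z) =
    R (br (R x) (R y) z + br (R x) y (R z) + br x (R y) (R z))

lemma sgn_add (a b : ZMod 2) : sgn K (a + b) = sgn K a * sgn K b := by
  have key : ∀ a b : ZMod 2, (a + b).val % 2 = (a.val + b.val) % 2 := by decide
  unfold sgn
  rw [← pow_add, neg_one_pow_eq_pow_mod_two, key, ← neg_one_pow_eq_pow_mod_two]

lemma skip2_val {m : ℕ} (i j : Fin (m + 3)) (k : Fin (m + 1)) :
    (skip2 i j k : ℕ) =
      if (k : ℕ) < i then (k : ℕ) else if (k : ℕ) + 1 < j then (k : ℕ) + 1 else (k : ℕ) + 2 := by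
  unfold skip2
  split_ifs <;> rfl

lemma skip2_strictMono {m : ℕ} (i j : Fin (m + 3)) : StrictMono (skip2 i j) := by
  intro k l hkl
  rw [Fin.lt_def] at hkl ⊢
  rw [skip2_val, skip2_val]
  split_ifs <;> omega

lemma skip2_ne_left {m : ℕ} (i j : Fin (m + 3)) (k : Fin (m + 1)) :
    skip2 i j k ≠ i := by
  rw [Ne, Fin.ext_iff, skip2_val]
  split_ifs <;> omega

lemma skip2_ne_right {m : ℕ} {i j : Fin (m + 3)} (hij : i < j) (k : Fin (m + 1)) :
    skip2 i j k ≠ j := by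
  rw [Fin.lt_def] at hij
  rw [Ne, Fin.ext_iff, skip2_val]
  split_ifs <;> omega

lemma exists_skip2_eq {m : ℕ} {i j : Fin (m + 3)} (hij : i < j) {l : Fin (m + 3)}
    (hi : l ≠ i) (hj : l ≠ j) : ∃ k, skip2 i j k = l := by
  rw [Fin.lt_def] at hij
  rw [Ne, Fin.ext_iff] at hi hj
  have hl := l.isLt
  have hj' := j.isLt
  rcases lt_trichotomy (l : ℕ) i with h | h | h
  · refine ⟨⟨l, by omega⟩, ?_⟩
    rw [Fin.ext_iff, skip2_val]
    dsimp only
    split_ifs <;> omega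
  · exact absurd h hi
  · by_cases h' : (l : ℕ) < j
    · refine ⟨⟨l - 1, by omega⟩, ?_⟩
      rw [Fin.ext_iff, skip2_val]
      dsimp only
      split_ifs <;> omega
    · refine ⟨⟨l - 2, by omega⟩, ?_⟩
      rw [Fin.ext_iff, skip2_val]
      dsimp only
      split_ifs <;> omega

/-- A sum over all positions splits into the two omitted ones and the remaining ones. -/
lemma sum_eq_add_sum_skip2 {M : Type*} [AddCommMonoid M] {m : ℕ} {i j : Fin (m + 3)}
    (hij : i < j) (f : Fin (m + 3) → M) :
    ∑ l, f l = f i + f j + ∑ k, f (skip2 i j k) := by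
  classical
  have himg : Finset.univ.image (skip2 i j) = (Finset.univ.erase i).erase j := by
    ext l
    simp only [Finset.mem_image, Finset.mem_univ, true_and, Finset.mem_erase, and_true]
    constructor
    · rintro ⟨k, rfl⟩
      exact ⟨skip2_ne_right hij k, skip2_ne_left i j k⟩
    · rintro ⟨h1, h2⟩
      exact exists_skip2_eq hij h2 h1
  rw [← Finset.sum_image (f := f) (s := Finset.univ) (g := skip2 i j)
    (fun a _ b _ h => (skip2_strictMono i j).injective h), himg, add_assoc,
    Finset.add_sum_erase _ _ (Finset.mem_erase.2 ⟨hij.ne', Finset.mem_univ j⟩),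
    Finset.add_sum_erase _ _ (Finset.mem_univ i)]

lemma sum_filter_update_add {n : ℕ} (d : Fin n → ZMod 2) (i : Fin n) (c : ZMod 2)
    (P : Fin n → Prop) [DecidablePred P] :
    ∑ l ∈ Finset.univ.filter P, Function.update d i (d i + c) l =
      ∑ l ∈ Finset.univ.filter P, d l + if P i then c else 0 := by
  have h : Function.update d i (d i + c) = fun l => d l + if l = i then c else 0 := by
    funext l
    by_cases hl : l = i
    · subst hl; simp
    · simp [hl]
  rw [h, Finset.sum_add_distrib, Finset.sum_ite_eq']
  simp

lemma sumAfter_update_add {n : ℕ} (d : Fin n → ZMod 2) (i j : Fin n) (c : ZMod 2) :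
    sumAfter (Function.update d i (d i + c)) j = sumAfter d j + if j < i then c else 0 :=
  sum_filter_update_add d i c _

lemma sumBetween_update_add {n : ℕ} (d : Fin n → ZMod 2) (i p q : Fin n) (c : ZMod 2) :
    sumBetween (Function.update d i (d i + c)) p q =
      sumBetween d p q + if p < i ∧ i < q then c else 0 :=
  sum_filter_update_add d i c _

lemma gamma_update_left {n : ℕ} (d : Fin n → ZMod 2) {p q : Fin n} (hpq : p < q)
    (c : ZMod 2) :
    gamma (Function.update d p (d p + c)) p q =
      gamma d p q + c * (sumAfter d q + sumBetween d p q) := by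
  simp only [gamma, sumAfter_update_add, sumBetween_update_add, Function.update_self,
    Function.update_of_ne hpq.ne', lt_irrefl, not_lt_of_gt hpq, false_and, if_false]
  ring

lemma gamma_update_right {n : ℕ} (d : Fin n → ZMod 2) {p q : Fin n} (hpq : p < q)
    (c : ZMod 2) :
    gamma (Function.update d q (d q + c)) p q = gamma d p q + c * sumAfter d q := by
  simp only [gamma, sumAfter_update_add, sumBetween_update_add, Function.update_self,
    Function.update_of_ne hpq.ne, lt_irrefl, and_false, if_false]
  ring

lemma gamma_update_of_ne {n : ℕ} (d : Fin n → ZMod 2) {p q i : Fin n} (hip : i ≠ p)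
    (hiq : i ≠ q) (c : ZMod 2) :
    gamma (Function.update d i (d i + c)) p q =
      gamma d p q + ((d p + d q) * (if q < i then c else 0) +
        d p * if p < i ∧ i < q then c else 0) := by
  simp only [gamma, sumAfter_update_add, sumBetween_update_add,
    Function.update_of_ne hip.symm, Function.update_of_ne hiq.symm]
  ring

lemma partSum_skip2 {m : ℕ} (d : Fin (m + 3) → ZMod 2) {p q : Fin (m + 3)} (hpq : p < q)
    (k : Fin (m + 1)) :
    partSum d (skip2 p q k) = (if p < skip2 p q k then d p else 0) +
      (if q < skip2 p q k then d q else 0) + partSum (d ∘ skip2 p q) k := by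
  simp only [partSum, Finset.sum_filter]
  rw [sum_eq_add_sum_skip2 hpq]
  simp only [(skip2_strictMono p q).lt_iff_lt, Function.comp_apply]

/-- Applying an operator of degree `c` at a position kept by `skip2` changes the sign `gamma` exactly
by the discrepancy between the partial degrees before and after omission. -/
lemma partSum_add_gamma_update_skip2 {m : ℕ} (d : Fin (m + 3) → ZMod 2) {p q : Fin (m + 3)}
    (hpq : p < q) (k : Fin (m + 1)) (c : ZMod 2) :
    c * partSum d (skip2 p q k) +
        gamma (Function.update d (skip2 p q k) (d (skip2 p q k) + c)) p q =
      c * partSum (d ∘ skip2 p q) k + gamma d p q := by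
  rw [gamma_update_of_ne d (skip2_ne_left p q k) (skip2_ne_right hpq k), partSum_skip2 d hpq]
  have h2 : ∀ a : ZMod 2, a + a = 0 := CharTwo.add_self_eq_zero
  have hp := skip2_ne_left p q k
  have hq := skip2_ne_right hpq k
  generalize skip2 p q k = l at *
  rcases lt_trichotomy l p with h | h | h
  · simp [not_lt_of_gt h, not_lt_of_gt (h.trans hpq)]
  · exact absurd h hp
  · rcases lt_trichotomy l q with h' | h' | h'
    · simp only [h, h', not_lt_of_gt h', if_true, if_false, and_self]
      linear_combination h2 (c * d p)
    · exact absurd h' hq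
    · simp only [h, h', not_lt_of_gt h', if_true, if_false, and_false]
      linear_combination h2 (c * d p) + h2 (c * d q)

lemma sum_comp_skip2 {m : ℕ} (d : Fin (m + 3) → ZMod 2) {p q : Fin (m + 3)} (hpq : p < q) :
    ∑ k, (d ∘ skip2 p q) k = partSum d p + sumBetween d p q + sumAfter d q := by
  have h := sum_eq_add_sum_skip2 hpq d
  have h' : ∑ l, d l = d p + d q + (partSum d p + sumBetween d p q + sumAfter d q) := by
    have e : ∀ l, d l = (if l = p then d l else 0) + (if l = q then d l else 0) +
        ((if l < p then d l else 0) + (if p < l ∧ l < q then d l else 0) +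
          (if q < l then d l else 0)) := by
      intro l
      rw [Fin.lt_def] at hpq
      simp only [Fin.lt_def, Fin.ext_iff]
      split_ifs <;> first | omega | simp
    rw [Finset.sum_congr rfl fun l _ => e l]
    simp only [Finset.sum_add_distrib, Finset.sum_ite_eq', Finset.mem_univ, if_true, partSum,
      sumBetween, sumAfter, Finset.sum_filter]
  exact add_left_cancel (h.symm.trans h')

lemma partSum_eq_add_sumBetween {n : ℕ} (d : Fin n → ZMod 2) {p q : Fin n} (hpq : p < q) :
    partSum d q = partSum d p + d p + sumBetween d p q := by
  have e : ∀ l, (if l < q then d l else 0) = (if l < p then d l else 0) +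
      (if l = p then d l else 0) + (if p < l ∧ l < q then d l else 0) := by
    intro l
    rw [Fin.lt_def] at hpq
    simp only [Fin.lt_def, Fin.ext_iff]
    split_ifs <;> first | omega | simp
  simp only [partSum, sumBetween, Finset.sum_filter]
  rw [Finset.sum_congr rfl fun l _ => e l]
  simp only [Finset.sum_add_distrib, Finset.sum_ite_eq', Finset.mem_univ, if_true]

lemma pow_mem_gr {gr : ZMod 2 → Submodule K V} {α : Module.End K V}
    (hα : ∀ (a : ZMod 2) (x : V), x ∈ gr a → α x ∈ gr a) (k : ℕ) (a : ZMod 2) (x : V)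
    (hx : x ∈ gr a) : (α ^ k) x ∈ gr a := by
  induction k with
  | zero => simpa using hx
  | succ k ih =>
    rw [pow_succ', Module.End.mul_apply]
    exact hα a _ ih

lemma update_mem_gr {gr : ZMod 2 → Submodule K V} {n : ℕ} {d : Fin n → ZMod 2}
    {y : Fin n → V} (hy : ∀ j, y j ∈ gr (d j)) (i : Fin n) {a : ZMod 2} {v : V}
    (hv : v ∈ gr a) (j : Fin n) :
    Function.update y i v j ∈ gr (Function.update d i a j) := by
  by_cases h : j = i
  · subst h; simpa using hv
  · simpa [h] using hy j

section Invariance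

variable {m : ℕ} {gr : ZMod 2 → Submodule K V} {α : Module.End K V}
  {φ : MultilinearMap K (fun _ : Fin (m + 1) => V) K}

/-- By skew-symmetry, invariance of `φ` under `α` in the first slot spreads to every slot. -/
lemma map_update_alpha (hα : ∀ (a : ZMod 2) (x : V), x ∈ gr a → α x ∈ gr a)
    (hφs : FormSuperSkew gr φ) (hc2 : PhiCond2 φ α) (i : Fin (m + 1)) :
    ∀ (d : Fin (m + 1) → ZMod 2) (y : Fin (m + 1) → V), (∀ j, y j ∈ gr (d j)) →
      φ (Function.update y i (α (y i))) = φ y := by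
  induction i using Fin.induction with
  | zero => exact fun _ y _ => hc2 y
  | succ i ih =>
    intro d y hy
    have hy' : ∀ j, Function.update y i.succ (α (y i.succ)) j ∈ gr (d j) := by
      intro j
      have h := update_mem_gr hy i.succ (hα _ _ (hy i.succ)) j
      rwa [Function.update_eq_self] at h
    rw [hφs d _ hy' i.castSucc i.succ (by simp), hφs d y hy i.castSucc i.succ (by simp)]
    congr 1
    have h := ih (d ∘ Equiv.swap i.castSucc i.succ) (y ∘ Equiv.swap i.castSucc i.succ)
      (fun j => hy _)
    rw [← h]
    congr 1
    funext j
    by_cases hj : j = i.castSucc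
    · subst hj; simp
    · have hj' : Equiv.swap i.castSucc i.succ j ≠ i.succ := by
        intro h
        apply hj
        rw [← Equiv.swap_apply_right i.castSucc i.succ] at h
        have := congrArg (Equiv.swap i.castSucc i.succ) h
        simpa using this
      simp [hj, hj']

lemma map_update_alpha_pow (hα : ∀ (a : ZMod 2) (x : V), x ∈ gr a → α x ∈ gr a)
    (hφs : FormSuperSkew gr φ) (hc2 : PhiCond2 φ α) (k : ℕ) (i : Fin (m + 1))
    (d : Fin (m + 1) → ZMod 2) (y : Fin (m + 1) → V) (hy : ∀ j, y j ∈ gr (d j)) :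
    φ (Function.update y i ((α ^ k) (y i))) = φ y := by
  induction k with
  | zero => simp
  | succ k ih =>
    have hy' := update_mem_gr hy i (pow_mem_gr hα k _ _ (hy i))
    have h := map_update_alpha hα hφs hc2 i _ _ hy'
    rw [Function.update_self, Function.update_idem, ih] at h
    rw [pow_succ', Module.End.mul_apply, h]

lemma map_piecewise_alpha_pow (hα : ∀ (a : ZMod 2) (x : V), x ∈ gr a → α x ∈ gr a)
    (hφs : FormSuperSkew gr φ) (hc2 : PhiCond2 φ α) (k : ℕ)
    (d : Fin (m + 1) → ZMod 2) (y : Fin (m + 1) → V) (hy : ∀ j, y j ∈ gr (d j))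
    (s : Finset (Fin (m + 1))) :
    φ (s.piecewise (fun j => (α ^ k) (y j)) y) = φ y := by
  induction s using Finset.induction_on with
  | empty => simp
  | insert i s hi ih =>
    have hy' : ∀ j, s.piecewise (fun j => (α ^ k) (y j)) y j ∈ gr (d j) := by
      intro j
      by_cases hj : j ∈ s
      · simpa [hj] using pow_mem_gr hα k _ _ (hy j)
      · simpa [hj] using hy j
    have h := map_update_alpha_pow hα hφs hc2 k i d _ hy'
    rw [Finset.piecewise_eq_of_notMem _ _ _ hi, ih] at h
    rw [Finset.piecewise_insert, h]

lemma map_alpha_pow (hα : ∀ (a : ZMod 2) (x : V), x ∈ gr a → α x ∈ gr a)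
    (hφs : FormSuperSkew gr φ) (hc2 : PhiCond2 φ α) (k : ℕ)
    (d : Fin (m + 1) → ZMod 2) (y : Fin (m + 1) → V) (hy : ∀ j, y j ∈ gr (d j)) :
    φ (fun j => (α ^ k) (y j)) = φ y := by
  simpa using map_piecewise_alpha_pow hα hφs hc2 k d y hy Finset.univ

lemma map_update_alpha_pow_of_mem (hα : ∀ (a : ZMod 2) (x : V), x ∈ gr a → α x ∈ gr a)
    (hφs : FormSuperSkew gr φ) (hc2 : PhiCond2 φ α) (k : ℕ)
    (d : Fin (m + 1) → ZMod 2) (y : Fin (m + 1) → V) (hy : ∀ j, y j ∈ gr (d j))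
    (i : Fin (m + 1)) {a : ZMod 2} {v : V} (hv : v ∈ gr a) :
    φ (Function.update (fun j => (α ^ k) (y j)) i v) = φ (Function.update y i v) := by
  rw [← map_piecewise_alpha_pow hα hφs hc2 k _ _ (update_mem_gr hy i hv) (Finset.univ.erase i)]
  congr 1
  funext j
  by_cases hj : j = i
  · subst hj; simp
  · simp [hj]

end Invariance

theorem stmt4 (m k : ℕ) (gr : ZMod 2 → Submodule K V) (br : V →ₗ[K] V →ₗ[K] V)
    (α : Module.End K V) (hg : IsHomLieSuper gr br α)
    (hmult : ∀ u v : V, α (br u v) = br (α u) (α v))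
    (φ : MultilinearMap K (fun _ : Fin (m + 1) => V) K)
    (hφe : FormEven gr φ) (hφs : FormSuperSkew gr φ)
    (hc1 : PhiCond1 gr br φ) (hc2 : PhiCond2 φ α)
    (dD : ZMod 2) (D D' : Module.End K V)
    (hDgr : ∀ (a : ZMod 2) (x : V), x ∈ gr a → D x ∈ gr (a + dD))
    (hquasi : ∀ (a b : ZMod 2) (x y : V), x ∈ gr a → y ∈ gr b →
      br (D x) ((α ^ k) y) + sgn K (dD * a) • br ((α ^ k) x) (D y) = D' (br x y))
    (hφD : ∀ (d : Fin (m + 1) → ZMod 2) (x : Fin (m + 1) → V), (∀ i, x i ∈ gr (d i)) →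
      ∑ i : Fin (m + 1), sgn K (dD * partSum d i) * φ (Function.update x i (D (x i))) = 0) :
    ∀ (d : Fin (m + 3) → ZMod 2) (x : Fin (m + 3) → V), (∀ i, x i ∈ gr (d i)) →
      ∑ i : Fin (m + 3), sgn K (dD * partSum d i) •
        phiBr br φ (Function.update d i (d i + dD))
          (Function.update (fun j => (α ^ k) (x j)) i (D (x i)))
        = D' (phiBr br φ d x) := by
  intro d x hx
  have hα := hg.alpha_even
  simp only [phiBr, Finset.smul_sum, map_sum]
  rw [Finset.sum_comm]
  refine Finset.sum_congr rfl fun pq hpq => ?_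
  obtain ⟨p, q⟩ := pq
  replace hpq : p < q := by simpa using hpq
  dsimp only
  have hxs : ∀ j, (x ∘ skip2 p q) j ∈ gr ((d ∘ skip2 p q) j) := fun j => hx _
  rw [sum_eq_add_sum_skip2 hpq]
  have hrest : ∑ l : Fin (m + 1), sgn K (dD * partSum d (skip2 p q l)) •
      ((-1 : K) ^ ((p : ℕ) + (q : ℕ) + 1) *
        sgn K (gamma (Function.update d (skip2 p q l) (d (skip2 p q l) + dD)) p q) *
        φ (Function.update (fun j => (α ^ k) (x j)) (skip2 p q l) (D (x (skip2 p q l))) ∘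
          skip2 p q)) •
      br (Function.update (fun j => (α ^ k) (x j)) (skip2 p q l) (D (x (skip2 p q l))) p)
        (Function.update (fun j => (α ^ k) (x j)) (skip2 p q l) (D (x (skip2 p q l))) q) = 0 := by
    have hterm : ∀ l : Fin (m + 1), sgn K (dD * partSum d (skip2 p q l)) •
        ((-1 : K) ^ ((p : ℕ) + (q : ℕ) + 1) *
          sgn K (gamma (Function.update d (skip2 p q l) (d (skip2 p q l) + dD)) p q) *
          φ (Function.update (fun j => (α ^ k) (x j)) (skip2 p q l) (D (x (skip2 p q l))) ∘
            skip2 p q)) •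
        br (Function.update (fun j => (α ^ k) (x j)) (skip2 p q l) (D (x (skip2 p q l))) p)
          (Function.update (fun j => (α ^ k) (x j)) (skip2 p q l) (D (x (skip2 p q l))) q) =
        ((sgn K (dD * partSum (d ∘ skip2 p q) l) *
          φ (Function.update (x ∘ skip2 p q) l (D ((x ∘ skip2 p q) l)))) *
          ((-1 : K) ^ ((p : ℕ) + (q : ℕ) + 1) * sgn K (gamma d p q))) •
          br ((α ^ k) (x p)) ((α ^ k) (x q)) := by
      intro l
      rw [Function.update_of_ne (skip2_ne_left p q l).symm,
        Function.update_of_ne (skip2_ne_right hpq l).symm,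
        Function.update_comp_eq_of_injective _ (skip2_strictMono p q).injective]
      have hφ := map_update_alpha_pow_of_mem hα hφs hc2 k _ _ hxs l (hDgr _ _ (hxs l))
      simp only [Function.comp_def] at hφ ⊢
      rw [hφ, smul_smul]
      congr 1
      have hs := congrArg (sgn K) (partSum_add_gamma_update_skip2 d hpq l dD)
      rw [sgn_add, sgn_add] at hs
      simp only [Function.comp_def] at hs
      linear_combination (-1 : K) ^ ((p : ℕ) + (q : ℕ) + 1) *
        φ (Function.update (fun j => x (skip2 p q j)) l (D (x (skip2 p q l)))) * hs
    rw [Finset.sum_congr rfl fun l _ => hterm l, ← Finset.sum_smul, ← Finset.sum_mul,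
      hφD _ _ hxs, zero_mul, zero_smul]
  rw [hrest, add_zero, gamma_update_left d hpq, gamma_update_right d hpq]
  simp only [Function.update_self, Function.update_of_ne hpq.ne, Function.update_of_ne hpq.ne',
    Function.update_comp_eq_of_forall_ne _ _ (skip2_ne_left p q),
    Function.update_comp_eq_of_forall_ne _ _ (skip2_ne_right hpq)]
  have hφ : φ ((fun j => (α ^ k) (x j)) ∘ skip2 p q) = φ (x ∘ skip2 p q) :=
    map_alpha_pow hα hφs hc2 k _ _ hxs
  rw [hφ, map_smul, ← hquasi _ _ _ _ (hx p) (hx q)]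
  by_cases hd : ∑ j, (d ∘ skip2 p q) j = 0
  · rw [sum_comp_skip2 d hpq] at hd
    have h1 : sgn K (dD * partSum d p) *
        sgn K (gamma d p q + dD * (sumAfter d q + sumBetween d p q)) = sgn K (gamma d p q) := by
      rw [← sgn_add]
      congr 1
      linear_combination dD * hd
    have h2 : sgn K (dD * partSum d q) * sgn K (gamma d p q + dD * sumAfter d q) =
        sgn K (gamma d p q) * sgn K (dD * d p) := by
      rw [← sgn_add, ← sgn_add, partSum_eq_add_sumBetween d hpq]
      congr 1
      linear_combination dD * hd
    rw [smul_smul, smul_smul, smul_add, smul_smul]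
    congr 2
    · linear_combination (-1 : K) ^ ((p : ℕ) + (q : ℕ) + 1) * φ (x ∘ skip2 p q) * h1
    · linear_combination (-1 : K) ^ ((p : ℕ) + (q : ℕ) + 1) * φ (x ∘ skip2 p q) * h2
  · simp [hφe _ _ hxs hd]

end NHomSuper
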